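/- Fix η ∈ ℝ with 0 ≤ η ≤ 1 and let B be a nonnegative beam-splitter coefficient family for η. Then for all I, K, n ∈ ℕ, Γ_n^{(I,K)} := ∑_{i=0}^{I} ∑_{k=0}^{K} (B^{(i,k)}_n − B^{(i,k)}_{n+1}) ≥ 0. (This says that the passive-environment bosonic channel with environment equal to the unnormalized projector onto the first K+1 Fock states maps the unnormalized projector onto the first I+1 Fock states to a passive, i.e. non-increasing in the Fock index, output.) -/

import Mathlib

/-- Extension of a coefficient family to integer indices: terms with a negative
index are set to zero (they are "omitted" in the recurrence). -/
noncomputable def bsExt (B : ℕ → ℕ → ℕ → ℝ) : ℤ → ℤ → ℤ → ℝ :=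
  fun i k m => if 0 ≤ i ∧ 0 ≤ k ∧ 0 ≤ m then B i.toNat k.toNat m.toNat else 0

/-- A beam-splitter coefficient family for transmittance `η`:
`B^{(i,k)}_m` are the Fock-basis transition probabilities of a beam splitter,
determined by the initial condition `B^{(0,0)}_0 = 1`, the vanishing condition
`B^{(i,k)}_m = 0` for `m > i + k`, and the recurrence relation (terms with a
negative index being omitted). -/
structure IsBSFamily (η : ℝ) (B : ℕ → ℕ → ℕ → ℝ) : Prop where
  init : B 0 0 0 = 1
  vanish : ∀ i k m : ℕ, i + k < m → B i k m = 0
  recur : ∀ i k m : ℕ, m ≤ i + k → ¬(i = 0 ∧ k = 0 ∧ m = 0) →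
    B i k m =
      η * bsExt B ((i : ℤ) - 1) (k : ℤ) ((m : ℤ) - 1)
        + (1 - η) * bsExt B ((i : ℤ) - 1) (k : ℤ) (m : ℤ)
        + η * bsExt B (i : ℤ) ((k : ℤ) - 1) (m : ℤ)
        + (1 - η) * bsExt B (i : ℤ) ((k : ℤ) - 1) ((m : ℤ) - 1)
        - bsExt B ((i : ℤ) - 1) ((k : ℤ) - 1) ((m : ℤ) - 1)

theorem bs_rec {η : ℝ} {B : ℕ → ℕ → ℕ → ℝ} (hB : IsBSFamily η B) (i k n : ℕ) :
    (i = 0 → k = 0 → B i k (n+1) = 0) ∧ (¬ (i = 0 ∧ k = 0) → B i k (n+1) =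
      η * bsExt B ((i : ℤ) - 1) (k : ℤ) (n : ℤ)
        + (1 - η) * bsExt B ((i : ℤ) - 1) (k : ℤ) ((n+1 : ℕ) : ℤ)
        + η * bsExt B (i : ℤ) ((k : ℤ) - 1) ((n+1 : ℕ) : ℤ)
        + (1 - η) * bsExt B (i : ℤ) ((k : ℤ) - 1) (n : ℤ)
        - bsExt B ((i : ℤ) - 1) ((k : ℤ) - 1) (n : ℤ)) := by
  refine ⟨fun h1 h2 => hB.vanish _ _ _ (by omega), fun h => ?_⟩
  by_cases hm : n + 1 ≤ i + k
  · have := hB.recur i k (n+1) hm (by omega)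
    have e : ((n + 1 : ℕ) : ℤ) - 1 = n := by push_cast; ring
    rw [e] at this
    exact this
  · have z : ∀ a b c : ℤ, a + b < c → bsExt B a b c = 0 := by
      intro a b c habc
      unfold bsExt
      split_ifs with h0
      · exact hB.vanish _ _ _ (by omega)
      · rfl
    rw [hB.vanish _ _ _ (by omega), z _ _ _ (by omega), z _ _ _ (by omega), z _ _ _ (by omega),
      z _ _ _ (by omega), z _ _ _ (by omega)]
    ring

theorem bsExt_nat (B : ℕ → ℕ → ℕ → ℝ) (i k m : ℕ) : bsExt B i k m = B i k m := by
  simp [bsExt]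

theorem bsExt_neg1 (B : ℕ → ℕ → ℕ → ℝ) (k m : ℤ) : bsExt B (-1) k m = 0 := by
  simp [bsExt]

theorem bsExt_neg2 (B : ℕ → ℕ → ℕ → ℝ) (k m : ℤ) : bsExt B k (-1) m = 0 := by
  simp [bsExt]

theorem bs_rec0 {η : ℝ} {B : ℕ → ℕ → ℕ → ℝ} (hB : IsBSFamily η B) (k n : ℕ) :
    B 0 (k+1) (n+1) = η * B 0 k (n+1) + (1 - η) * B 0 k n := by
  have h := (bs_rec hB 0 (k+1) n).2 (by omega)
  have e : ((k + 1 : ℕ) : ℤ) - 1 = k := by push_cast; ring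
  have e0 : ((0 : ℕ) : ℤ) - 1 = -1 := by norm_num
  rw [e, e0] at h
  simp only [bsExt_neg1, bsExt_nat] at h
  linarith

theorem bs_rec1 {η : ℝ} {B : ℕ → ℕ → ℕ → ℝ} (hB : IsBSFamily η B) (i n : ℕ) :
    B (i+1) 0 (n+1) = η * B i 0 n + (1 - η) * B i 0 (n+1) := by
  have h := (bs_rec hB (i+1) 0 n).2 (by omega)
  have e : ((i + 1 : ℕ) : ℤ) - 1 = i := by push_cast; ring
  have e0 : ((0 : ℕ) : ℤ) - 1 = -1 := by norm_num
  rw [e, e0] at h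
  simp only [bsExt_neg2, bsExt_nat] at h
  linarith

theorem bs_rec2 {η : ℝ} {B : ℕ → ℕ → ℕ → ℝ} (hB : IsBSFamily η B) (i k n : ℕ) :
    B (i+1) (k+1) (n+1) = η * B i (k+1) n + (1 - η) * B i (k+1) (n+1)
      + η * B (i+1) k (n+1) + (1 - η) * B (i+1) k n - B i k n := by
  have h := (bs_rec hB (i+1) (k+1) n).2 (by omega)
  have e : ((i + 1 : ℕ) : ℤ) - 1 = i := by push_cast; ring
  have e0 : ((k + 1 : ℕ) : ℤ) - 1 = k := by push_cast; ring
  rw [e, e0] at h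
  simpa only [bsExt_nat] using h

/-- For a nonnegative beam-splitter coefficient family `B` for `η ∈ [0,1]`,
`Γ_n^{(I,K)} = ∑_{i=0}^{I} ∑_{k=0}^{K} (B^{(i,k)}_n − B^{(i,k)}_{n+1}) ≥ 0`
(the channel `B^[K]_η` maps the unnormalized projector `P_I` to a passive output). -/
theorem bsGamma_nonneg
    (η : ℝ) (hη0 : 0 ≤ η) (hη1 : η ≤ 1)
    (B : ℕ → ℕ → ℕ → ℝ) (hB : IsBSFamily η B) (hBnn : ∀ i k m, 0 ≤ B i k m) :
    ∀ I K n : ℕ,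
      0 ≤ ∑ i ∈ Finset.range (I + 1), ∑ k ∈ Finset.range (K + 1),
            (B i k n - B i k (n + 1)) := by
  intro I K n
  obtain ⟨G, hG⟩ : ∃ G : ℕ → ℕ → ℝ, ∀ i k, G i k =
      ∑ a ∈ Finset.range i, ∑ b ∈ Finset.range k, (B a b n - B a b (n + 1)) := ⟨_, fun _ _ => rfl⟩
  rw [← hG]
  have g0 : ∀ k, G 0 k = 0 := fun k => by simp [hG]
  have g1 : ∀ i, G i 0 = 0 := fun k => by simp [hG]
  have gs : ∀ i k, G (i+1) (k+1) = G (i+1) k + G i (k+1) - G i k + (B i k n - B i k (n+1)) := by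
    intro i k
    simp only [hG, Finset.sum_range_succ _ i, Finset.sum_range_succ _ k]
    ring
  have Q : ∀ i k, G (i+1) (k+1) = B i k n + (1 - η) * G i (k+1) + η * G (i+1) k := by
    intro i
    induction i with
    | zero =>
      intro k
      induction k with
      | zero =>
        rw [gs]
        simp [g0, g1, hB.vanish 0 0 (n+1) (by omega)]
      | succ k ih =>
        have h := gs 0 (k+1)
        have h' := gs 0 k
        have r := bs_rec0 hB k n
        simp only [g0, zero_add] at *
        linear_combination h + ih - η * h' - r
    | succ i ihi =>
      intro k
      induction k with
      | zero =>
        have h := gs (i+1) 0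
        have h' := gs i 0
        have ih := ihi 0
        have r := bs_rec1 hB i n
        simp only [g1, zero_add] at *
        linear_combination h + ih - (1 - η) * h' - r
      | succ k ih =>
        have h := gs (i+1) (k+1)
        have h1 := gs i (k+1)
        have h2 := gs (i+1) k
        have i1 := ihi (k+1)
        have i2 := ihi k
        have r := bs_rec2 hB i k n
        linear_combination h + ih + i1 - i2 - (1 - η) * h1 - η * h2 - r
  have P : ∀ i k, 0 ≤ G i k := by
    intro i
    induction i with
    | zero => intro k; rw [g0]
    | succ i ihi =>
      intro k
      induction k with
      | zero => rw [g1]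
      | succ k ih =>
        rw [Q]
        have a := hBnn i k n
        have b := mul_nonneg (sub_nonneg.2 hη1) (ihi (k+1))
        have c := mul_nonneg hη0 ih
        linarith
  exact P _ _
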